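/- arXiv:2403.12716 — 2 statements merged into one kernel-verified Lean document; each statement's English description precedes it below -/
import Mathlib

section
/- Let R be a commutative ring, n : ℕ, D : ℕ, and p, q : MvPolynomial (Fin n) R multivariate polynomials with degreeOf i p < D and degreeOf i q < D for every i : Fin n. If φ_D p = φ_D q, then p = q. In other words, standard Kronecker substitution with parameter D is injective on the set of multivariate polynomials whose degree in each variable is less than D. -/
open MvPolynomial Polynomial

/-- Standard Kronecker substitution: sends `X i` to `x ^ (D ^ i)`. -/
noncomputable def kroneckerSubst (R : Type*) [CommRing R] (n D : ℕ) :
    MvPolynomial (Fin n) R →ₐ[R] Polynomial R :=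
  MvPolynomial.aeval (fun i : Fin n => (Polynomial.X : Polynomial R) ^ (D ^ (i : ℕ)))

/-- Base-`D` expansions of length `n` with digits less than `D` are determined by their value. -/
theorem sum_mul_pow_injOn (n D : ℕ) :
    Set.InjOn (fun m : Fin n →₀ ℕ => ∑ i, m i * D ^ (i : ℕ)) {m | ∀ i, m i < D} := by
  intro a ha b hb hab
  have h : (fun i => ⟨a i, ha i⟩ : Fin n → Fin D) = fun i => ⟨b i, hb i⟩ := by
    apply finFunctionFinEquiv.injective
    ext
    simpa only [finFunctionFinEquiv_apply] using hab
  ext i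
  simpa using congrFun h i

theorem kroneckerSubst_eq_sum {R : Type*} [CommRing R] (n D : ℕ) (p : MvPolynomial (Fin n) R) :
    kroneckerSubst R n D p =
      ∑ m ∈ p.support, Polynomial.monomial (∑ i, m i * D ^ (i : ℕ)) (p.coeff m) := by
  rw [kroneckerSubst, MvPolynomial.aeval_def, MvPolynomial.eval₂_eq']
  refine Finset.sum_congr rfl fun m _ => ?_
  rw [← Polynomial.C_mul_X_pow_eq_monomial, ← Finset.prod_pow_eq_pow_sum]
  simp only [← pow_mul, mul_comm (D ^ _), Polynomial.algebraMap_eq]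

/-- Kronecker substitution preserves the coefficients of polynomials of small degree in each
variable. -/
theorem coeff_kroneckerSubst {R : Type*} [CommRing R] {n D : ℕ} {p : MvPolynomial (Fin n) R}
    (hp : ∀ i, p.degreeOf i < D) {m : Fin n →₀ ℕ} (hm : ∀ i, m i < D) :
    (kroneckerSubst R n D p).coeff (∑ i, m i * D ^ (i : ℕ)) = p.coeff m := by
  rw [kroneckerSubst_eq_sum, Polynomial.finsetSum_coeff, Finset.sum_eq_single m]
  · exact Polynomial.coeff_monomial_same _ _
  · intro b hb hbm
    refine Polynomial.coeff_monomial_of_ne _ fun h => hbm ?_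
    exact sum_mul_pow_injOn n D
      (fun i => (MvPolynomial.monomial_le_degreeOf i hb).trans_lt (hp i)) hm h.symm
  · intro h
    rw [MvPolynomial.notMem_support_iff.mp h, Polynomial.monomial_zero_right,
      Polynomial.coeff_zero]

theorem stmt_3 {R : Type*} [CommRing R] (n D : ℕ)
    (p q : MvPolynomial (Fin n) R)
    (hp : ∀ i : Fin n, p.degreeOf i < D) (hq : ∀ i : Fin n, q.degreeOf i < D)
    (h : kroneckerSubst R n D p = kroneckerSubst R n D q) : p = q := by
  ext m
  by_cases hm : ∀ i, m i < D
  · rw [← coeff_kroneckerSubst hp hm, h, coeff_kroneckerSubst hq hm]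
  · obtain ⟨i, hi⟩ := not_forall.mp hm
    have coeff_eq_zero {r : MvPolynomial (Fin n) R} (hr : r.degreeOf i < D) : r.coeff m = 0 := by
      by_contra h0
      exact hi ((MvPolynomial.monomial_le_degreeOf i
        (MvPolynomial.mem_support_iff.mpr h0)).trans_lt hr)
    rw [coeff_eq_zero (hp i), coeff_eq_zero (hq i)]
end

section
/- Let R be a commutative ring, n : ℕ, h : MvPolynomial (Fin n) R, and i, j : Fin n with i ≠ j. Let D : ℕ with D > degreeOf j h and let ψ = ψ_{i→j,D}. Then degreeOf i (ψ h) = 0, and for every index m : Fin n with m ≠ i and m ≠ j, degreeOf m (ψ h) = degreeOf m h. -/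
open MvPolynomial

/-- Single Kronecker substitution: sends `X i` to `(X j) ^ D` and fixes every other variable. -/
noncomputable def singleKron (R : Type*) [CommRing R] {n : ℕ} (i j : Fin n) (D : ℕ) :
    MvPolynomial (Fin n) R →ₐ[R] MvPolynomial (Fin n) R :=
  MvPolynomial.aeval (fun m : Fin n =>
    if m = i then (MvPolynomial.X j : MvPolynomial (Fin n) R) ^ D else MvPolynomial.X m)

/-- The effect of the substitution `X i ↦ (X j) ^ D` on exponent vectors. -/
noncomputable def kronExponent {n : ℕ} (i j : Fin n) (D : ℕ) (s : Fin n →₀ ℕ) : Fin n →₀ ℕ :=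
  s.erase i + Finsupp.single j (D * s i)

theorem kronExponent_apply_self {n : ℕ} {i j : Fin n} (hij : i ≠ j) (D : ℕ) (s : Fin n →₀ ℕ) :
    kronExponent i j D s i = 0 := by
  simp [kronExponent, hij]

theorem kronExponent_apply_target {n : ℕ} {i j : Fin n} (hij : i ≠ j) (D : ℕ)
    (s : Fin n →₀ ℕ) : kronExponent i j D s j = s j + D * s i := by
  simp [kronExponent, Finsupp.erase_ne hij.symm]

theorem kronExponent_apply_of_ne {n : ℕ} {i j m : Fin n} (hi : m ≠ i) (hj : m ≠ j) (D : ℕ)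
    (s : Fin n →₀ ℕ) : kronExponent i j D s m = s m := by
  simp [kronExponent, Finsupp.erase_ne hi, hj]

theorem kronExponent_injOn {n : ℕ} {i j : Fin n} (hij : i ≠ j) (D : ℕ) :
    Set.InjOn (kronExponent i j D) {s | s j < D} := by
  intro s hs t ht hst
  have key : s j + D * s i = t j + D * t i := by
    rw [← kronExponent_apply_target hij, hst, kronExponent_apply_target hij]
  have hj : s j = t j := by
    simpa [Nat.mod_eq_of_lt hs.out, Nat.mod_eq_of_lt ht.out] using congrArg (· % D) key
  ext m
  by_cases hmj : m = j
  · rw [hmj, hj]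
  by_cases hmi : m = i
  · rw [hj] at key
    rw [hmi]
    exact Nat.eq_of_mul_eq_mul_left (pos_of_gt hs.out) (Nat.add_left_cancel key)
  · rw [← kronExponent_apply_of_ne hmi hmj D, hst, kronExponent_apply_of_ne hmi hmj]

theorem singleKron_monomial {R : Type*} [CommRing R] {n : ℕ} (i j : Fin n) (D : ℕ)
    (s : Fin n →₀ ℕ) (a : R) :
    singleKron R i j D (monomial s a) = monomial (kronExponent i j D s) a := by
  have erase_monomial : singleKron R i j D (monomial (s.erase i) a) = monomial (s.erase i) a := by
    rw [singleKron, aeval_monomial, monomial_eq, algebraMap_eq]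
    congr 1
    refine Finsupp.prod_congr fun m hm => ?_
    rw [if_neg (by rintro rfl; simp at hm)]
  have single_monomial : singleKron R i j D (monomial (Finsupp.single i (s i)) 1) =
      monomial (Finsupp.single j (D * s i)) 1 := by
    rw [← X_pow_eq_monomial, ← X_pow_eq_monomial, map_pow, singleKron, aeval_X, if_pos rfl, pow_mul]
  calc singleKron R i j D (monomial s a)
      = singleKron R i j D (monomial (s.erase i) a * monomial (Finsupp.single i (s i)) 1) := by
        rw [monomial_mul, mul_one, Finsupp.erase_add_single]
    _ = monomial (kronExponent i j D s) a := by
        rw [map_mul, erase_monomial, single_monomial, monomial_mul, mul_one, kronExponent]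

theorem support_singleKron {R : Type*} [CommRing R] {n : ℕ} {h : MvPolynomial (Fin n) R}
    {i j : Fin n} (hij : i ≠ j) {D : ℕ} (hD : h.degreeOf j < D) :
    (singleKron R i j D h).support = h.support.image (kronExponent i j D) := by
  have hlt : ∀ s ∈ h.support, s j < D := fun s hs => (monomial_le_degreeOf j hs).trans_lt hD
  have hcoeff : ∀ t, coeff t (singleKron R i j D h) =
      ∑ s ∈ h.support, if kronExponent i j D s = t then coeff s h else 0 := by
    intro t
    conv_lhs => rw [h.as_sum]
    simp only [map_sum, singleKron_monomial, coeff_sum, coeff_monomial]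
  ext t
  rw [mem_support_iff, Finset.mem_image]
  constructor
  · intro ht
    rw [hcoeff] at ht
    obtain ⟨s, hs, hne⟩ := Finset.exists_ne_zero_of_sum_ne_zero ht
    exact ⟨s, hs, by_contra fun hst => hne (if_neg hst)⟩
  · rintro ⟨s, hs, rfl⟩
    rw [hcoeff, Finset.sum_eq_single_of_mem s hs, if_pos rfl]
    · exact mem_support_iff.mp hs
    · intro t ht hts
      exact if_neg fun heq => hts (kronExponent_injOn hij D (hlt t ht) (hlt s hs) heq)

theorem stmt_7 {R : Type*} [CommRing R] {n : ℕ} (h : MvPolynomial (Fin n) R)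
    (i j : Fin n) (hij : i ≠ j) (D : ℕ) (hD : h.degreeOf j < D) :
    (singleKron R i j D h).degreeOf i = 0 ∧
      ∀ m : Fin n, m ≠ i → m ≠ j →
        (singleKron R i j D h).degreeOf m = h.degreeOf m := by
  simp only [degreeOf_eq_sup, support_singleKron hij hD, Finset.sup_image]
  constructor
  · simp [Function.comp_def, kronExponent_apply_self hij]
  · intro m hi hj
    exact Finset.sup_congr rfl fun s _ => kronExponent_apply_of_ne hi hj D s
end
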